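/- Let M ≥ N ≥ 3 and let F : U → ℝ^N be a real analytic map on an open neighborhood U ∋ 0 in ℝ^M with F(0) = 0, such that F is tame and Disc F ⊆ {0}. Let π : ℝ^N → ℝ^{N-1} be the canonical projection (y₁, …, y_N) ↦ (y₁, …, y_{N-1}). Then the composition π ∘ F is tame and Disc(π ∘ F) ⊆ {0}. -/

import Mathlib

open Metric Set Function Topology

noncomputable section

/-- The singular set of a map: points where the total derivative is not surjective. -/
def Sing {E F : Type*} [NormedAddCommGroup E] [NormedSpace ℝ E] [NormedAddCommGroup F]
    [NormedSpace ℝ F] (P : E → F) : Set E :=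
  {x | ¬ Function.Surjective ⇑(fderiv ℝ P x)}

/-- The Milnor set of a map (with respect to the Euclidean distance `‖x‖²`):
points where the derivative of `x ↦ (P x, ‖x‖²)` is not surjective. -/
def MilnorSet {E F : Type*} [NormedAddCommGroup E] [NormedSpace ℝ E] [NormedAddCommGroup F]
    [NormedSpace ℝ F] (P : E → F) : Set E :=
  {x | ¬ Function.Surjective ⇑(fderiv ℝ (fun y => (P y, ‖y‖ ^ 2)) x)}

/-- Tameness: as set germs at the origin, `closure(M(P) \ Sing P) ∩ Sing P ⊆ {0}`. -/
def Tame {E F : Type*} [NormedAddCommGroup E] [NormedSpace ℝ E] [NormedAddCommGroup F]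
    [NormedSpace ℝ F] (P : E → F) : Prop :=
  ∃ ε > 0, closure ((MilnorSet P \ Sing P) ∩ ball (0 : E) ε) ∩ Sing P ∩ ball (0 : E) ε ⊆ {0}

lemma exists_deriv_ext {A L : Type} [CommRing A] [IsDomain A] [Field L] [CharZero L] [Algebra A L]
    [FaithfulSMul A L] (D0 : A →+ L)
    (hmul : ∀ a b, D0 (a * b) = algebraMap A L a * D0 b + algebraMap A L b * D0 a) :
    ∃ D : Derivation ℤ L L, ∀ a, D (algebraMap A L a) = D0 a := by
  have hone : D0 1 = 0 := by
    have := hmul 1 1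
    simp at this
    exact this
  have smooth : Algebra.FormallySmooth A L := by
    let _ : Algebra (FractionRing A) L := FractionRing.liftAlgebra A L
    have : IsScalarTower A (FractionRing A) L := inferInstance
    have : CharZero (FractionRing A) := by
      constructor
      intro a b hab
      have := congrArg (algebraMap (FractionRing A) L) hab
      simpa using this
    have : Algebra.FormallySmooth A (FractionRing A) := .of_isLocalization (nonZeroDivisors A)
    obtain ⟨_, s, hs⟩ := exists_isTranscendenceBasis' (FractionRing A) L
    have := hs.isAlgebraic_field
    have : Algebra.FormallySmooth (FractionRing A) L :=
      Algebra.FormallySmooth.of_algebraicIndependent_of_isSeparable hs.1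
    exact .comp _ (FractionRing A) _
  let φ : A →+* TrivSqZeroExt L L :=
    { toFun := fun a => TrivSqZeroExt.inl (algebraMap A L a) + TrivSqZeroExt.inr (D0 a)
      map_one' := by simp [hone]
      map_zero' := by simp
      map_add' := fun a b => by ext <;> simp
      map_mul' := fun a b => by
        ext
        · simp
        · simp [hmul, mul_comm] }
  let _ : Algebra A (TrivSqZeroExt L L) := φ.toAlgebra
  let g : TrivSqZeroExt L L →ₐ[A] L :=
    { (TrivSqZeroExt.fstHom ℤ L L).toRingHom with
      commutes' := fun a => by
        change TrivSqZeroExt.fst (φ a) = _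
        simp [φ] }
  have hgs : Function.Surjective g := fun y => ⟨TrivSqZeroExt.inl y, rfl⟩
  have hgn : IsNilpotent (RingHom.ker (g : TrivSqZeroExt L L →+* L)) := by
    refine ⟨2, ?_⟩
    refine le_antisymm ?_ bot_le
    refine (pow_two (RingHom.ker (g : TrivSqZeroExt L L →+* L))).le.trans ?_
    rw [Ideal.mul_le]
    intro x hx y hy
    have hx : x.fst = 0 := hx
    have hy : y.fst = 0 := hy
    change x * y = 0
    ext <;> simp [hx, hy]
  let ψ := Algebra.FormallySmooth.liftOfSurjective (AlgHom.id A L) g hgs hgn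
  have hψ : ∀ y, (ψ y).fst = y := fun y =>
    Algebra.FormallySmooth.liftOfSurjective_apply (AlgHom.id A L) g hgs hgn y
  refine ⟨Derivation.mk' (AddMonoidHom.toIntLinearMap
    { toFun := fun y => (ψ y).snd, map_zero' := by simp, map_add' := by simp }) ?_, ?_⟩
  · intro a b
    simp [hψ, mul_comm]
  · intro a
    have : ψ (algebraMap A L a) = φ a := ψ.commutes a
    change (ψ (algebraMap A L a)).snd = D0 a
    rw [this]
    simp [φ]

open Polynomial in
lemma exists_const_poly {A L : Type} [CommRing A] [IsDomain A] [Field L] [Algebra A L]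
    [FaithfulSMul A L] (S : Set (Derivation ℤ L L)) (C : Set L) (z : L) (hz : IsAlgebraic A z)
    (hS : ∀ D ∈ S, ∀ a : A, ∃ b : A, D (algebraMap A L a) = algebraMap A L b)
    (hSz : ∀ D ∈ S, D z = 0)
    (hC : ∀ a b : A, b ≠ 0 → (∀ D ∈ S, D (algebraMap A L a / algebraMap A L b) = 0) →
      algebraMap A L a / algebraMap A L b ∈ C) :
    ∃ P : L[X], P.Monic ∧ (∀ i, P.coeff i ∈ C) ∧ P.eval z = 0 := by
  let _ : Algebra (FractionRing A) L := FractionRing.liftAlgebra A L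
  have hinj : ∀ b : A, b ≠ 0 → algebraMap A L b ≠ 0 := fun b hb h =>
    hb ((FaithfulSMul.algebraMap_injective A L) (by simpa using h))
  have hk : ∀ c : FractionRing A, ∃ a b : A, b ≠ 0 ∧
      algebraMap (FractionRing A) L c = algebraMap A L a / algebraMap A L b := by
    intro c
    obtain ⟨a, b, hb, rfl⟩ := IsFractionRing.div_surjective (A := A) c
    refine ⟨a, b, nonZeroDivisors.ne_zero hb, ?_⟩
    rw [map_div₀, ← IsScalarTower.algebraMap_apply, ← IsScalarTower.algebraMap_apply]
  have hzk : IsAlgebraic (FractionRing A) z := hz.extendScalars (IsFractionRing.injective A _)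
  have hIntg : IsIntegral (FractionRing A) z := hzk.isIntegral
  set m := minpoly (FractionRing A) z with hm
  have hmon : m.Monic := minpoly.monic hIntg
  have key : ∀ i, ∀ D ∈ S, D (algebraMap (FractionRing A) L (m.coeff i)) = 0 := by
    intro i D hD
    have hDk : ∀ c : FractionRing A, ∃ d : FractionRing A,
        D (algebraMap (FractionRing A) L c) = algebraMap (FractionRing A) L d := by
      intro c
      obtain ⟨a, b, hb, h⟩ := hk c
      obtain ⟨a', ha'⟩ := hS D hD a
      obtain ⟨b', hb'⟩ := hS D hD b
      refine ⟨(algebraMap A _ b * algebraMap A _ a' - algebraMap A _ a * algebraMap A _ b') /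
        (algebraMap A _ b)^2, ?_⟩
      rw [h, Derivation.leibniz_div]
      simp only [map_div₀, map_sub, map_mul, map_pow, ← IsScalarTower.algebraMap_apply, ha', hb',
        smul_eq_mul]
      have := hinj b hb
      field_simp
    choose d hd using hDk
    have hd1 : d 1 = 0 := by
      have := hd 1
      simp at this
      exact (map_eq_zero _).1 this.symm
    let q : (FractionRing A)[X] := ∑ j ∈ Finset.range m.natDegree, Polynomial.monomial j (d (m.coeff j))
    have hq0 : aeval z q = 0 := by
      have h1 : aeval z m = 0 := minpoly.aeval _ _
      rw [Polynomial.aeval_eq_sum_range] at h1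
      have h2 := congrArg D h1
      rw [map_sum, Finset.sum_range_succ, map_zero] at h2
      have h3 : ∀ j, D (m.coeff j • z ^ j) = algebraMap _ L (d (m.coeff j)) * z ^ j := by
        intro j
        rw [Algebra.smul_def, D.leibniz, D.leibniz_pow, hSz D hD, hd]
        simp [mul_comm]
      simp only [h3] at h2
      rw [show m.coeff m.natDegree = 1 from hmon, hd1] at h2
      simp only [q, map_sum, aeval_monomial]
      simpa using h2
    have hqd : q = 0 := by
      by_contra hne
      have h1 := minpoly.degree_le_of_ne_zero (FractionRing A) z hne hq0
      have h2 : q.degree < m.degree := by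
        rw [Polynomial.degree_eq_natDegree hmon.ne_zero]
        refine (Polynomial.degree_sum_le _ _).trans_lt ?_
        rw [Finset.sup_lt_iff (WithBot.bot_lt_coe _)]
        intro j hj
        refine (Polynomial.degree_monomial_le _ _).trans_lt ?_
        simpa using hj
      exact absurd h1 (not_le.2 h2)
    rcases lt_trichotomy i m.natDegree with h | h | h
    · have : q.coeff i = d (m.coeff i) := by
        simp only [q, Polynomial.finsetSum_coeff, Polynomial.coeff_monomial]
        simp [h]
      rw [hd, ← this, hqd]; simp
    · rw [h, show m.coeff m.natDegree = 1 from hmon]; simp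
    · rw [Polynomial.coeff_eq_zero_of_natDegree_lt h]; simp
  refine ⟨m.map (algebraMap _ L), hmon.map _, ?_, ?_⟩
  · intro i
    rw [Polynomial.coeff_map]
    obtain ⟨a, b, hb, h⟩ := hk (m.coeff i)
    rw [h]
    apply hC a b hb
    intro D hD
    rw [← h]; exact key i D hD
  · rw [Polynomial.eval_map_algebraMap]; exact minpoly.aeval _ _


/-- ultrapower of the reals -/
abbrev HL : Type := Filter.Germ (Filter.hyperfilter ℕ : _root_.Filter ℕ) ℝ

/-- germ of a real sequence -/
def gm (u : ℕ → ℝ) : HL := (u : HL)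

lemma gm_eq {u v : ℕ → ℝ} : gm u = gm v ↔ ∀ᶠ k in (Filter.hyperfilter ℕ : _root_.Filter ℕ), u k = v k :=
  Filter.Germ.coe_eq
lemma gm_add (u v : ℕ → ℝ) : gm (fun k => u k + v k) = gm u + gm v := rfl
lemma gm_sub (u v : ℕ → ℝ) : gm (fun k => u k - v k) = gm u - gm v := rfl
lemma gm_neg (u : ℕ → ℝ) : gm (fun k => - u k) = - gm u := rfl
lemma gm_mul (u v : ℕ → ℝ) : gm (fun k => u k * v k) = gm u * gm v := rfl
lemma gm_pow (u : ℕ → ℝ) (n : ℕ) : gm (fun k => u k ^ n) = gm u ^ n := rfl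
lemma gm_zero : gm (fun _ => 0) = 0 := rfl
lemma gm_one : gm (fun _ => 1) = 1 := rfl
lemma gm_sum {ι : Type} (s : Finset ι) (u : ι → ℕ → ℝ) :
    gm (fun k => ∑ i ∈ s, u i k) = ∑ i ∈ s, gm (u i) := by
  classical
  induction s using Finset.induction_on with
  | empty => simp [gm_zero]
  | insert a s ha ih => simp only [Finset.sum_insert ha, gm_add, ih]
lemma gm_surj (z : HL) : ∃ u, gm u = z := by
  induction z using Filter.Germ.inductionOn with
  | _ u => exact ⟨u, rfl⟩


open Polynomial in
lemma real_of_const_poly (z : HL) (P : HL[X]) (hP : P.Monic)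
    (hc : ∀ i, P.coeff i ∈ Set.range (fun c : ℝ => gm (fun _ => c))) (h : P.eval z = 0) :
    ∃ c : ℝ, z = gm (fun _ => c) := by
  choose c hc using hc
  obtain ⟨u, rfl⟩ := gm_surj z
  let Q : ℝ[X] := Polynomial.X ^ P.natDegree +
    ∑ i ∈ Finset.range P.natDegree, Polynomial.monomial i (c i)
  have hQ : Q.Monic := by
    apply Polynomial.monic_X_pow_add
    refine (Polynomial.degree_sum_le _ _).trans_lt ?_
    rw [Finset.sup_lt_iff (WithBot.bot_lt_coe _)]
    intro j hj
    refine (Polynomial.degree_monomial_le _ _).trans_lt ?_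
    simpa using hj
  have h1 : gm (fun k => Q.eval (u k)) = 0 := by
    simp only [Q, Polynomial.eval_add, Polynomial.eval_pow, Polynomial.eval_X,
      Polynomial.eval_finsetSum, Polynomial.eval_monomial]
    rw [gm_add, gm_sum, gm_pow]
    simp only [gm_mul, gm_pow]
    rw [Polynomial.eval_eq_sum_range, Finset.sum_range_succ,
      show P.coeff P.natDegree = 1 from hP] at h
    rw [← h, one_mul, add_comm]
    congr 1
    apply Finset.sum_congr rfl
    intro i _
    rw [← hc i]
  have h2 : ∀ᶠ k in (Filter.hyperfilter ℕ : _root_.Filter ℕ), u k ∈ (Q.roots.toFinset : Set ℝ) := by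
    refine (gm_eq.1 (h1.trans gm_zero.symm)).mono fun k hk => ?_
    simpa [hQ.ne_zero] using hk
  have h3 : ∃ r ∈ (Q.roots.toFinset : Set ℝ), ∀ᶠ k in (Filter.hyperfilter ℕ : _root_.Filter ℕ), u k = r := by
    have := (Ultrafilter.eventually_exists_mem_iff (f := Filter.hyperfilter ℕ)
      (Q.roots.toFinset.finite_toSet) (P := fun r k => u k = r)).1
      (h2.mono fun k hk => ⟨u k, hk, rfl⟩)
    exact this
  obtain ⟨r, -, hr⟩ := h3
  exact ⟨r, gm_eq.2 hr⟩

section anring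
variable {V : Type} [NormedAddCommGroup V] [NormedSpace ℝ V]

/-- ring of values of analytic germs at the infinitesimal point `x` -/
def anRing (x : ℕ → V) : Subring HL where
  carrier := {z | ∃ f : V → ℝ, AnalyticAt ℝ f 0 ∧ gm (fun k => f (x k)) = z}
  mul_mem' := by
    rintro _ _ ⟨f, hf, rfl⟩ ⟨g, hg, rfl⟩
    exact ⟨fun y => f y * g y, hf.mul hg, rfl⟩
  one_mem' := ⟨fun _ => 1, analyticAt_const, rfl⟩
  add_mem' := by
    rintro _ _ ⟨f, hf, rfl⟩ ⟨g, hg, rfl⟩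
    exact ⟨fun y => f y + g y, hf.add hg, rfl⟩
  zero_mem' := ⟨fun _ => 0, analyticAt_const, rfl⟩
  neg_mem' := by
    rintro _ ⟨f, hf, rfl⟩
    exact ⟨fun y => - f y, hf.neg, rfl⟩

/-- derivations satisfying the chain rule for analytic germs at the infinitesimal point `x` -/
def AnDer (x : ℕ → V) (D : Derivation ℤ HL HL) : Prop :=
  ∃ v : ℕ → V, ∀ f : V → ℝ, AnalyticAt ℝ f 0 →
    D (gm (fun k => f (x k))) = gm (fun k => fderiv ℝ f (x k) (v k))

variable {x : ℕ → V} (hx : Filter.Tendsto x (Filter.hyperfilter ℕ : _root_.Filter ℕ) (𝓝 0))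
include hx

lemma gm_fderiv_add {f g : V → ℝ} (hf : AnalyticAt ℝ f 0) (hg : AnalyticAt ℝ g 0) (v : ℕ → V) :
    gm (fun k => fderiv ℝ (fun y => f y + g y) (x k) (v k)) =
      gm (fun k => fderiv ℝ f (x k) (v k)) + gm (fun k => fderiv ℝ g (x k) (v k)) := by
  rw [← gm_add, gm_eq]
  filter_upwards [hx.eventually hf.eventually_analyticAt, hx.eventually hg.eventually_analyticAt]
    with k h1 h2
  rw [fderiv_fun_add h1.differentiableAt h2.differentiableAt]
  rfl

lemma gm_fderiv_mul {f g : V → ℝ} (hf : AnalyticAt ℝ f 0) (hg : AnalyticAt ℝ g 0) (v : ℕ → V) :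
    gm (fun k => fderiv ℝ (fun y => f y * g y) (x k) (v k)) =
      gm (fun k => f (x k)) * gm (fun k => fderiv ℝ g (x k) (v k)) +
      gm (fun k => g (x k)) * gm (fun k => fderiv ℝ f (x k) (v k)) := by
  rw [← gm_mul, ← gm_mul, ← gm_add, gm_eq]
  filter_upwards [hx.eventually hf.eventually_analyticAt, hx.eventually hg.eventually_analyticAt]
    with k h1 h2
  rw [fderiv_fun_mul h1.differentiableAt h2.differentiableAt]
  rfl

lemma gm_fderiv_congr {f g : V → ℝ} (h : f =ᶠ[𝓝 0] g) (v : ℕ → V) :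
    gm (fun k => fderiv ℝ f (x k) (v k)) = gm (fun k => fderiv ℝ g (x k) (v k)) := by
  rw [gm_eq]
  filter_upwards [hx.eventually (Filter.EventuallyEq.fderiv (𝕜 := ℝ) h)] with k hk
  rw [hk]

lemma const_of_wronskian [FiniteDimensional ℝ V] 
    (hind : ∀ f : V → ℝ, AnalyticAt ℝ f 0 → gm (fun k => f (x k)) = 0 → f =ᶠ[𝓝 0] 0)
    {f g : V → ℝ} (hf : AnalyticAt ℝ f 0) (hg : AnalyticAt ℝ g 0)
    (hg0 : gm (fun k => g (x k)) ≠ 0)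
    (hW : ∀ v : V, gm (fun k => g (x k)) * gm (fun k => fderiv ℝ f (x k) v) =
      gm (fun k => f (x k)) * gm (fun k => fderiv ℝ g (x k) v)) :
    ∃ c : ℝ, gm (fun k => f (x k)) = gm (fun _ => c) * gm (fun k => g (x k)) := by
  have h1 : ∀ v : V, ∀ᶠ y in 𝓝 (0 : V), g y * fderiv ℝ f y v - f y * fderiv ℝ g y v = 0 := by
    intro v
    have han : ∀ {f : V → ℝ}, AnalyticAt ℝ f 0 → AnalyticAt ℝ (fun y => fderiv ℝ f y v) 0 := by
      intro f hf
      exact (ContinuousLinearMap.apply ℝ ℝ v).analyticAt _ |>.comp hf.fderiv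
    have := hind (fun y => g y * fderiv ℝ f y v - f y * fderiv ℝ g y v)
      ((hg.mul (han hf)).sub (hf.mul (han hg)))
      (by rw [gm_sub, gm_mul, gm_mul, hW, sub_self])
    exact this
  let b := Module.finBasis ℝ V
  have h2 : ∀ᶠ y in 𝓝 (0 : V), g y • fderiv ℝ f y - f y • fderiv ℝ g y = 0 := by
    have : ∀ᶠ y in 𝓝 (0 : V), ∀ i, g y * fderiv ℝ f y (b i) - f y * fderiv ℝ g y (b i) = 0 :=
      Filter.eventually_all.2 fun i => h1 (b i)
    filter_upwards [this] with y hy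
    apply ContinuousLinearMap.coe_injective
    refine b.ext fun i => ?_
    simpa using hy i
  obtain ⟨r, hr, hball⟩ := Metric.eventually_nhds_iff_ball.1
    (h2.and (hf.eventually_analyticAt.and hg.eventually_analyticAt))
  have hex : ∃ y0 ∈ ball (0 : V) r, g y0 ≠ 0 := by
    by_contra hcon
    push Not at hcon
    apply hg0
    rw [← gm_zero, gm_eq]
    filter_upwards [hx.eventually (ball_mem_nhds _ hr)] with k hk
    exact hcon _ hk
  obtain ⟨y0, hy0, hgy0⟩ := hex
  have hcont : ContinuousAt g y0 := (hball y0 hy0).2.2.continuousAt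
  obtain ⟨s, hs, hsub⟩ := Metric.eventually_nhds_iff_ball.1
    ((hcont.eventually_ne hgy0).and (isOpen_ball.mem_nhds hy0))
  have hconst : ∀ y ∈ ball y0 s, f y / g y = f y0 / g y0 := by
    have hd : ∀ y ∈ ball y0 s, HasFDerivAt (fun y => f y / g y) (0 : V →L[ℝ] ℝ) y := by
      intro y hy
      obtain ⟨hgy, hyr⟩ := hsub y hy
      obtain ⟨e1, e2, e3⟩ := hball y hyr
      have hi := (hasDerivAt_inv hgy).comp_hasFDerivAt y e3.differentiableAt.hasFDerivAt
      have := e2.differentiableAt.hasFDerivAt.mul hi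
      have hz : f y • (-(g y ^ 2)⁻¹) • fderiv ℝ g y + (g y)⁻¹ • fderiv ℝ f y = 0 := by
        have h5 : f y • (-(g y ^ 2)⁻¹) • fderiv ℝ g y + (g y)⁻¹ • fderiv ℝ f y =
            ((g y) ^ 2)⁻¹ • (g y • fderiv ℝ f y - f y • fderiv ℝ g y) := by
          ext v
          simp
          field_simp
          ring
        rw [h5, e1, smul_zero]
      rw [← hz]
      have e5 : (fun y => f y / g y) = f * (fun y => y⁻¹) ∘ g := by
        ext y
        simp [div_eq_mul_inv]
      rw [e5]
      exact this
    intro y hy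
    refine (convex_ball y0 s).is_const_of_fderivWithin_eq_zero (𝕜 := ℝ) (f := fun y => f y / g y)
      (fun y hy => (hd y hy).differentiableAt.differentiableWithinAt) (fun y hy => ?_) hy
      (mem_ball_self hs)
    rw [fderivWithin_of_isOpen isOpen_ball hy, (hd y hy).fderiv]
  refine ⟨f y0 / g y0, ?_⟩
  have hEq : EqOn f (fun y => (f y0 / g y0) * g y) (ball 0 r) := by
    refine AnalyticOnNhd.eqOn_of_preconnected_of_eventuallyEq (𝕜 := ℝ) (z₀ := y0)
      (fun y hy => (hball y hy).2.1)
      (fun y hy => analyticAt_const.mul (hball y hy).2.2) (convex_ball 0 r).isPreconnected hy0 ?_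
    filter_upwards [ball_mem_nhds y0 hs] with y hy
    rw [← hconst y hy, div_mul_cancel₀ _ (hsub y hy).1]
  rw [← gm_mul, gm_eq]
  filter_upwards [hx.eventually (ball_mem_nhds _ hr)] with k hk
  exact hEq hk

lemma indep_case [FiniteDimensional ℝ V]
    (hind : ∀ f : V → ℝ, AnalyticAt ℝ f 0 → gm (fun k => f (x k)) = 0 → f =ᶠ[𝓝 0] 0)
    (z : HL) (hz : IsAlgebraic (anRing x) z) (hD : ∀ D, AnDer x D → D z = 0) :
    ∃ c : ℝ, z = gm (fun _ => c) := by
  have hrep : ∀ a : anRing x, ∃ f : V → ℝ, AnalyticAt ℝ f 0 ∧ gm (fun k => f (x k)) = a :=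
    fun a => a.2
  choose φ hφ1 hφ2 using hrep
  have hwd : ∀ (f g : V → ℝ) (v : V), AnalyticAt ℝ f 0 → AnalyticAt ℝ g 0 →
      gm (fun k => f (x k)) = gm (fun k => g (x k)) →
      gm (fun k => fderiv ℝ f (x k) v) = gm (fun k => fderiv ℝ g (x k) v) := by
    intro f g v hf hg h
    apply gm_fderiv_congr hx
    have := hind (fun y => f y - g y) (hf.sub hg) (by rw [gm_sub, h, sub_self])
    filter_upwards [this] with y hy
    exact sub_eq_zero.1 hy
  have hDv : ∀ v : V, ∃ D : Derivation ℤ HL HL, ∀ f : V → ℝ, AnalyticAt ℝ f 0 →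
      D (gm (fun k => f (x k))) = gm (fun k => fderiv ℝ f (x k) v) := by
    intro v
    let D0 : anRing x →+ HL :=
      { toFun := fun a => gm (fun k => fderiv ℝ (φ a) (x k) v)
        map_zero' := by
          rw [hwd (φ 0) (fun _ => 0) v (hφ1 0) analyticAt_const (hφ2 0)]
          simp [gm_zero]
        map_add' := fun a b => by
          rw [← gm_fderiv_add hx (hφ1 a) (hφ1 b) (fun _ => v)]
          refine hwd _ _ v (hφ1 _) ((hφ1 a).add (hφ1 b)) ?_
          rw [gm_add, hφ2, hφ2, hφ2]
          rfl }
    obtain ⟨D, hD⟩ := exists_deriv_ext D0 (fun a b => by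
      have e := gm_fderiv_mul hx (hφ1 a) (hφ1 b) (fun _ => v)
      rw [hφ2, hφ2] at e
      refine Eq.trans ?_ e
      refine hwd _ _ v (hφ1 _) ((hφ1 a).mul (hφ1 b)) ?_
      rw [gm_mul, hφ2, hφ2, hφ2]
      rfl)
    refine ⟨D, fun f hf => ?_⟩
    have := hD ⟨_, f, hf, rfl⟩
    refine this.trans ?_
    exact hwd _ _ v (hφ1 _) hf (hφ2 _)
  choose D hDf using hDv
  have hDA : ∀ v, AnDer x (D v) := fun v => ⟨fun _ => v, hDf v⟩
  obtain ⟨P, hPm, hPc, hP0⟩ := exists_const_poly (A := anRing x) (Set.range D)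
    (Set.range (fun c : ℝ => gm (fun _ => c))) z hz
    (by
      rintro _ ⟨v, rfl⟩ ⟨_, f, hf, rfl⟩
      refine ⟨⟨gm (fun k => fderiv ℝ f (x k) v), fun y => fderiv ℝ f y v, ?_, rfl⟩, hDf v f hf⟩
      exact (ContinuousLinearMap.apply ℝ ℝ v).analyticAt _ |>.comp hf.fderiv)
    (by rintro _ ⟨v, rfl⟩; exact hD _ (hDA v))
    (by
      rintro ⟨_, f, hf, rfl⟩ ⟨_, g, hg, rfl⟩ hb h
      have hb' : gm (fun k => g (x k)) ≠ 0 := fun h => hb (Subtype.ext h)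
      change gm (fun k => f (x k)) / gm (fun k => g (x k)) ∈ _
      obtain ⟨c, hc⟩ := const_of_wronskian hx hind hf hg hb' (by
        intro v
        have := h (D v) ⟨v, rfl⟩
        change D v (gm (fun k => f (x k)) / gm (fun k => g (x k))) = 0 at this
        rw [Derivation.leibniz_div, hDf v f hf, hDf v g hg] at this
        rw [smul_eq_zero] at this
        rcases this with h | h
        · simp [hb'] at h
        · exact sub_eq_zero.1 h)
      exact ⟨c, by rw [hc, mul_div_cancel_right₀ _ hb']⟩)
  exact real_of_const_poly z P hPm hPc hP0
end anring

section tilde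
variable {V X 𝒜 : Type} [NormedAddCommGroup V] [NormedSpace ℝ V]
  [NormedAddCommGroup X] [NormedSpace ℝ X] [NormedRing 𝒜] [NormedAlgebra ℝ 𝒜]
  {ι : Type} [Fintype ι]

/-- the extension of a power series to noncommuting arguments -/
def tildeSeries (b : Module.Basis ι ℝ V) (ℓ : ι → X →L[ℝ] 𝒜) (p : FormalMultilinearSeries ℝ V ℝ) :
    FormalMultilinearSeries ℝ X 𝒜 := fun k =>
  ∑ i : Fin k → ι, p k (fun j => b (i j)) •
    (ContinuousMultilinearMap.mkPiAlgebraFin ℝ k 𝒜).compContinuousLinearMap (fun j => ℓ (i j))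

lemma tildeSeries_apply (b : Module.Basis ι ℝ V) (ℓ : ι → X →L[ℝ] 𝒜)
    (p : FormalMultilinearSeries ℝ V ℝ) (k : ℕ) (y : X) :
    tildeSeries b ℓ p k (fun _ => y) =
      ∑ i : Fin k → ι, p k (fun j => b (i j)) • (List.ofFn (fun j => ℓ (i j) y)).prod := by
  simp [tildeSeries]

lemma series_expand (b : Module.Basis ι ℝ V) (p : FormalMultilinearSeries ℝ V ℝ) (k : ℕ) (v : V) :
    p k (fun _ => v) = ∑ i : Fin k → ι, p k (fun j => b (i j)) * ∏ j, b.repr v (i j) := by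
  classical
  conv_lhs => rw [← b.sum_repr v]
  rw [ContinuousMultilinearMap.map_sum]
  refine Finset.sum_congr rfl fun i _ => ?_
  rw [ContinuousMultilinearMap.map_smul_univ, smul_eq_mul, mul_comm]

lemma tildeSeries_radius [NormOneClass 𝒜] (b : Module.Basis ι ℝ V) (ℓ : ι → X →L[ℝ] 𝒜)
    (p : FormalMultilinearSeries ℝ V ℝ) (hp : 0 < p.radius) : 0 < (tildeSeries b ℓ p).radius := by
  obtain ⟨r, hr0, hr⟩ := ENNReal.lt_iff_exists_nnreal_btwn.1 hp
  have hr0 : 0 < r := by exact_mod_cast hr0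
  obtain ⟨C, hC, hbd⟩ := p.norm_mul_pow_le_of_lt_radius hr
  obtain ⟨B, hB0, hB⟩ : ∃ B : ℝ, 0 < B ∧ ∀ i, ‖b i‖ ≤ B := by
    refine ⟨∑ i, ‖b i‖ + 1, by positivity, fun i => ?_⟩
    have := Finset.single_le_sum (f := fun i => ‖b i‖) (fun i _ => norm_nonneg _) (Finset.mem_univ i)
    linarith
  obtain ⟨A, hA0, hA⟩ : ∃ A : ℝ, 0 < A ∧ ∀ i, ‖ℓ i‖ ≤ A := by
    refine ⟨∑ i, ‖ℓ i‖ + 1, by positivity, fun i => ?_⟩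
    have := Finset.single_le_sum (f := fun i => ‖ℓ i‖) (fun i _ => norm_nonneg _) (Finset.mem_univ i)
    linarith
  set n : ℝ := Fintype.card ι + 1 with hn
  have hn0 : 0 < n := by positivity
  let s : NNReal := ⟨r / (n * B * A), by positivity⟩
  have hs : 0 < s := by
    change (0 : ℝ) < r / (n * B * A)
    have : (0 : ℝ) < r := hr0
    positivity
  refine lt_of_lt_of_le (ENNReal.coe_pos.2 hs) ((tildeSeries b ℓ p).le_radius_of_bound C fun k => ?_)
  have h1 : ‖tildeSeries b ℓ p k‖ ≤ n ^ k * (‖p k‖ * B ^ k * A ^ k) := by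
    refine (norm_sum_le _ _).trans ?_
    have : ∀ i ∈ (Finset.univ : Finset (Fin k → ι)), ‖p k (fun j => b (i j)) •
        (ContinuousMultilinearMap.mkPiAlgebraFin ℝ k 𝒜).compContinuousLinearMap
          (fun j => ℓ (i j))‖ ≤ ‖p k‖ * B ^ k * A ^ k := by
      intro i _
      refine (ContinuousMultilinearMap.opNorm_smul_le _ _).trans ?_
      refine mul_le_mul ?_ ?_ (ContinuousMultilinearMap.opNorm_nonneg _) (by positivity)
      · refine ((p k).le_opNorm _).trans ?_
        refine mul_le_mul_of_nonneg_left ?_ (norm_nonneg _)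
        refine (Finset.prod_le_prod (fun _ _ => norm_nonneg _) (fun j _ => hB (i j))).trans ?_
        simp
      · refine (ContinuousMultilinearMap.norm_compContinuousLinearMap_le _ _).trans ?_
        rw [ContinuousMultilinearMap.norm_mkPiAlgebraFin, one_mul]
        refine (Finset.prod_le_prod (fun _ _ => norm_nonneg _) (fun j _ => hA (i j))).trans ?_
        simp
    refine (Finset.sum_le_card_nsmul _ _ _ this).trans ?_
    rw [nsmul_eq_mul]
    refine mul_le_mul_of_nonneg_right ?_ (by positivity)
    simp only [Finset.card_univ, Fintype.card_fun, Fintype.card_fin, Nat.cast_pow]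
    gcongr
    linarith
  refine (mul_le_mul_of_nonneg_right h1 (by positivity)).trans ?_
  have : n ^ k * (‖p k‖ * B ^ k * A ^ k) * (s : ℝ) ^ k = ‖p k‖ * (r : ℝ) ^ k := by
    change _ * (r / (n * B * A) : ℝ) ^ k = _
    rw [div_pow, mul_pow, mul_pow]
    field_simp
  rw [this]
  exact hbd k

lemma exists_tilde [NormOneClass 𝒜] [CompleteSpace 𝒜]
    (b : Module.Basis ι ℝ V) (ℓ : ι → X →L[ℝ] 𝒜)
    (f : V → ℝ) (p : FormalMultilinearSeries ℝ V ℝ) (hf : HasFPowerSeriesAt f p 0) :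
    ∃ G : X → 𝒜, ∃ r > 0, AnalyticOnNhd ℝ G (ball 0 r) ∧
      (∀ y ∈ ball (0 : X) r, ∀ v ∈ ball (0 : V) r, ∀ ε : 𝒜 →L[ℝ] ℝ,
        (∀ i a, ε (ℓ i y * a) = b.repr v i * ε a) → ε (G y) = f v * ε 1) ∧
      (∀ y ∈ ball (0 : X) r, ∀ v s, (∀ i, ℓ i y = b.repr v i • s) →
        HasSum (fun k => p k (fun _ => v) • s ^ k) (G y)) := by
  have hrad := tildeSeries_radius b ℓ p hf.radius_pos
  obtain ⟨r1, hr1⟩ := hf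
  have h2 := (tildeSeries b ℓ p).hasFPowerSeriesOnBall hrad
  obtain ⟨r, hr0, hr⟩ := ENNReal.lt_iff_exists_nnreal_btwn.1 (lt_min hr1.r_pos hrad)
  have hr0 : 0 < r := by exact_mod_cast hr0
  have hbX : ∀ y ∈ ball (0 : X) r, y ∈ Metric.eball (0 : X) (tildeSeries b ℓ p).radius := by
    intro y hy
    rw [← Metric.eball_coe] at hy
    exact Metric.eball_subset_eball (hr.le.trans (min_le_right _ _)) hy
  have hbV : ∀ y ∈ ball (0 : V) r, y ∈ Metric.eball (0 : V) r1 := by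
    intro y hy
    rw [← Metric.eball_coe] at hy
    exact Metric.eball_subset_eball (hr.le.trans (min_le_left _ _)) hy
  refine ⟨(tildeSeries b ℓ p).sum, r, hr0, fun y hy => h2.analyticOnNhd y (hbX y hy), ?_, ?_⟩
  · intro y hy v hv ε hε
    have e1 := h2.hasSum (hbX y hy)
    have e2 := hr1.hasSum (hbV v hv)
    rw [zero_add] at e1 e2
    have e3 := e1.mapL ε
    have e4 := e2.mul_right (ε 1)
    refine e3.unique ?_
    convert! e4 using 2 with k
    have hprod : ∀ (k : ℕ) (i : Fin k → ι), ε (List.ofFn (fun j => ℓ (i j) y)).prod =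
        (∏ j, b.repr v (i j)) * ε 1 := by
      intro k
      induction k with
      | zero => intro i; simp
      | succ k ih =>
        intro i
        rw [List.ofFn_succ, List.prod_cons, hε, ih, Fin.prod_univ_succ, mul_assoc]
    rw [tildeSeries_apply, series_expand b, map_sum, Finset.sum_mul]
    refine Finset.sum_congr rfl fun i _ => ?_
    rw [map_smul, hprod, smul_eq_mul, mul_assoc]
  · intro y hy v s hs
    have e1 := h2.hasSum (hbX y hy)
    rw [zero_add] at e1
    convert! e1 using 2 with k
    have hprod : ∀ (k : ℕ) (i : Fin k → ι), (List.ofFn (fun j => ℓ (i j) y)).prod =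
        (∏ j, b.repr v (i j)) • s ^ k := by
      intro k
      induction k with
      | zero => intro i; simp
      | succ k ih =>
        intro i
        rw [List.ofFn_succ, List.prod_cons, hs, ih, Fin.prod_univ_succ, pow_succ', smul_mul_smul_comm]
    rw [tildeSeries_apply, series_expand b, Finset.sum_smul]
    refine Finset.sum_congr rfl fun i _ => ?_
    rw [hprod, smul_smul]
end tilde

/-- bounded sequences -/
abbrev Bs : Type := BoundedContinuousFunction ℕ ℝ

/-- right shift as a function -/
def shFun (u : Bs) : Bs := BoundedContinuousFunction.ofNormedAddCommGroupDiscrete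
  (fun n => Nat.casesOn n 0 (fun m => u m)) ‖u‖ (by
    intro n
    cases n with
    | zero => simp
    | succ m => exact u.norm_coe_le_norm m)

/-- left shift as a function -/
def lfFun (u : Bs) : Bs := BoundedContinuousFunction.ofNormedAddCommGroupDiscrete
  (fun n => u (n + 1)) ‖u‖ (fun _ => u.norm_coe_le_norm _)

/-- right shift -/
def ShB : Bs →L[ℝ] Bs := LinearMap.mkContinuous
  { toFun := shFun
    map_add' := fun u v => by
      ext n
      cases n with
      | zero => change (0 : ℝ) = 0 + 0; simp
      | succ m => rfl
    map_smul' := fun c u => by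
      ext n
      cases n with
      | zero => change (0 : ℝ) = c * 0; simp
      | succ m => rfl } 1 (fun u => by
        rw [one_mul]
        refine (BoundedContinuousFunction.norm_le (norm_nonneg _)).2 fun n => ?_
        cases n with
        | zero => change ‖(0 : ℝ)‖ ≤ _; simp
        | succ m => exact u.norm_coe_le_norm m)

/-- left shift -/
def LfB : Bs →L[ℝ] Bs := LinearMap.mkContinuous
  { toFun := lfFun
    map_add' := fun u v => rfl
    map_smul' := fun c u => rfl } 1 (fun u => by
        rw [one_mul]
        refine (BoundedContinuousFunction.norm_le (norm_nonneg _)).2 fun n => ?_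
        exact u.norm_coe_le_norm (n + 1))

/-- zeroth coordinate -/
def dlB : Bs →L[ℝ] ℝ := BoundedContinuousFunction.evalCLM ℝ 0

/-- zeroth unit vector -/
def e0B : Bs := BoundedContinuousFunction.ofNormedAddCommGroupDiscrete
  (fun n => if n = 0 then 1 else 0) 1 (by
    intro n
    split_ifs <;> simp)


/-- abstract shift operators on a Banach space -/
structure ShiftData (ℬ : Type) [NormedAddCommGroup ℬ] [NormedSpace ℝ ℬ] where
  Sh : ℬ →L[ℝ] ℬ
  Lf : ℬ →L[ℝ] ℬ
  dl : ℬ →L[ℝ] ℝ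
  e0 : ℬ
  Sh_norm : ‖Sh‖ ≤ 1
  Lf_norm : ‖Lf‖ ≤ 1
  Lf_Sh : Lf * Sh = 1
  Lf_e0 : Lf e0 = 0
  dl_Sh : ∀ u, dl (Sh u) = 0
  dl_e0 : dl e0 = 1

/-- concrete shift data -/
def shiftBs : ShiftData Bs where
  Sh := ShB
  Lf := LfB
  dl := dlB
  e0 := e0B
  Sh_norm := LinearMap.mkContinuous_norm_le _ zero_le_one _
  Lf_norm := LinearMap.mkContinuous_norm_le _ zero_le_one _
  Lf_Sh := rfl
  Lf_e0 := by
    ext n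
    rfl
  dl_Sh := fun _ => rfl
  dl_e0 := rfl

namespace ShiftData
variable {ℬ : Type} [NormedAddCommGroup ℬ] [NormedSpace ℝ ℬ] (B : ShiftData ℬ)

lemma Lf_pow_Sh_pow (d k : ℕ) : B.Lf ^ d * B.Sh ^ (d + k) = B.Sh ^ k := by
  induction d with
  | zero => simp
  | succ d ih =>
    rw [pow_succ, show d + 1 + k = (d + k) + 1 by ring, pow_succ', mul_assoc, ← mul_assoc B.Lf, B.Lf_Sh,
      one_mul, ih]

/-- evaluation functional `u ↦ ∑ uₖ τᵏ` -/
def ev (τ : ℝ) : ℬ →L[ℝ] ℝ := B.dl.comp (Ring.inverse (1 - τ • B.Lf))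

variable [CompleteSpace ℬ]

lemma isUnit_ev {τ : ℝ} (h : |τ| < 1) : IsUnit (1 - τ • B.Lf) := by
  apply isUnit_one_sub_of_norm_lt_one
  rw [norm_smul]
  calc ‖τ‖ * ‖B.Lf‖ ≤ ‖τ‖ * 1 := by gcongr; exact B.Lf_norm
    _ < 1 := by simpa using h

lemma ev_of_eq {τ : ℝ} (h : |τ| < 1) {u m : ℬ} (hm : u - τ • B.Lf u = m) : B.ev τ m = B.dl u := by
  have h1 := Ring.inverse_mul_cancel _ (B.isUnit_ev h)
  have h2 := congrArg (fun A : ℬ →L[ℝ] ℬ => A u) h1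
  change B.dl (Ring.inverse (1 - τ • B.Lf) m) = B.dl u
  rw [← hm]
  exact congrArg B.dl h2

lemma ev_eq_dl {τ : ℝ} (h : |τ| < 1) (m : ℬ) :
    ∃ u, u - τ • B.Lf u = m := by
  have h1 := Ring.mul_inverse_cancel _ (B.isUnit_ev h)
  exact ⟨Ring.inverse (1 - τ • B.Lf) m, congrArg (fun A : ℬ →L[ℝ] ℬ => A m) h1⟩

lemma ev_Sh {τ : ℝ} (h : |τ| < 1) (u : ℬ) : B.ev τ (B.Sh u) = τ * B.ev τ u := by
  obtain ⟨v, hv⟩ := B.ev_eq_dl h u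
  rw [B.ev_of_eq h hv, B.ev_of_eq h (u := B.Sh u + τ • v)]
  · simp [B.dl_Sh]
  · have : B.Lf (B.Sh u) = u := congrArg (fun A : ℬ →L[ℝ] ℬ => A u) B.Lf_Sh
    rw [map_add, map_smul, this, ← hv]
    module

lemma ev_e0 {τ : ℝ} (h : |τ| < 1) : B.ev τ B.e0 = 1 := by
  rw [B.ev_of_eq h (u := B.e0)]
  · exact B.dl_e0
  · simp [B.Lf_e0]

lemma ev_zero (u : ℬ) : B.ev 0 u = B.dl u := by
  simp [ev]

lemma ev_poly {τ : ℝ} (h : |τ| < 1) (d : ℕ) (m : ℬ) (hm : (B.Lf ^ d) m = 0) :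
    B.ev τ m = ∑ i ∈ Finset.range d, τ ^ i * B.dl ((B.Lf ^ i) m) := by
  have h0 := mul_neg_geom_sum (τ • B.Lf) d
  have h1 := congrArg (fun A : ℬ →L[ℝ] ℬ => A m) h0
  rw [B.ev_of_eq h (u := (∑ i ∈ Finset.range d, (τ • B.Lf) ^ i) m)]
  · rw [sum_apply, map_sum]
    refine Finset.sum_congr rfl fun i _ => ?_
    rw [smul_pow]
    simp
  · refine h1.trans ?_
    rw [smul_pow]
    change m - τ ^ d • (B.Lf ^ d) m = m
    rw [hm, smul_zero, sub_zero]

lemma ev_analytic : AnalyticAt ℝ B.ev 0 := by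
  have h1 : AnalyticAt ℝ (fun τ : ℝ => (1 : ℬ →L[ℝ] ℬ) - τ • B.Lf) 0 :=
    analyticAt_const.sub (analyticAt_id.smul analyticAt_const)
  have h2 : AnalyticAt ℝ (Ring.inverse : (ℬ →L[ℝ] ℬ) → _) ((1 : ℬ →L[ℝ] ℬ) - (0 : ℝ) • B.Lf) := by
    have := analyticAt_inverse (𝕜 := ℝ) (1 : (ℬ →L[ℝ] ℬ)ˣ)
    simpa using this
  have h3 : AnalyticAt ℝ (fun τ : ℝ => Ring.inverse ((1 : ℬ →L[ℝ] ℬ) - τ • B.Lf)) 0 :=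
    AnalyticAt.comp_of_eq (f := fun τ : ℝ => (1 : ℬ →L[ℝ] ℬ) - τ • B.Lf) h2 h1 rfl
  exact ((ContinuousLinearMap.compL ℝ ℬ ℬ ℝ B.dl).analyticAt _).comp h3

end ShiftData

section weier

lemma an_clm_apply {E F H : Type} [NormedAddCommGroup E] [NormedSpace ℝ E] [NormedAddCommGroup F]
    [NormedSpace ℝ F] [NormedAddCommGroup H] [NormedSpace ℝ H] {T : E → F →L[ℝ] H} {u : E → F}
    {x : E} (hT : AnalyticAt ℝ T x) (hu : AnalyticAt ℝ u x) :
    AnalyticAt ℝ (fun y => T y (u y)) x := by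
  have h1 := (ContinuousLinearMap.id ℝ (F →L[ℝ] H)).analyticAt_bilinear (T x, u x)
  exact AnalyticAt.comp_of_eq (f := fun y => (T y, u y)) h1 (hT.prod hu) rfl

lemma isUnit_of_hasSum {𝒜 : Type} [NormedRing 𝒜] [NormedAlgebra ℝ 𝒜] [NormOneClass 𝒜]
    [CompleteSpace 𝒜]
    {a : ℕ → ℝ} {s Φ : 𝒜} {ρ C R : ℝ} (hC : 0 < C) (hρ : 0 < ρ) (hρR : ρ ≤ R / 2)
    (hs : ‖s‖ ≤ ρ)
    (ha : ∀ k, |a (k + 1)| * R ^ k ≤ C) (h0 : 2 * C * ρ < |a 0|)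
    (h : HasSum (fun k => a k • s ^ k) Φ) : IsUnit Φ := by
  have ha0 : a 0 ≠ 0 := by
    intro h
    rw [h, abs_zero] at h0
    have : 0 < 2 * C * ρ := by positivity
    linarith
  have h1 : HasSum (fun k => a (k + 1) • s ^ (k + 1)) (Φ - a 0 • 1) := by
    have := (hasSum_nat_add_iff' 1).2 h
    simpa using this
  have hgeo : HasSum (fun k : ℕ => C * ρ * (1 / 2 : ℝ) ^ k) (C * ρ * 2) := by
    exact hasSum_geometric_two.mul_left _
  have h2 : ‖Φ - a 0 • 1‖ ≤ C * ρ * 2 := by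
    rw [← h1.tsum_eq]
    refine tsum_of_norm_bounded hgeo fun k => ?_
    rw [norm_smul]
    have e1 : ‖s ^ (k + 1)‖ ≤ ρ ^ (k + 1) := (norm_pow_le s _).trans (by gcongr)
    have e2 : ρ ^ k ≤ R ^ k * (1 / 2) ^ k := by
      rw [← mul_pow]
      gcongr
      linarith
    calc ‖a (k + 1)‖ * ‖s ^ (k + 1)‖ ≤ |a (k + 1)| * ρ ^ (k + 1) := by
          gcongr
          exact le_rfl
      _ = |a (k + 1)| * ρ * ρ ^ k := by ring
      _ ≤ |a (k + 1)| * ρ * (R ^ k * (1 / 2) ^ k) := by gcongr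
      _ = (|a (k + 1)| * R ^ k) * ρ * (1 / 2) ^ k := by ring
      _ ≤ C * ρ * (1 / 2) ^ k := by
          have := ha k
          gcongr
  have h3 : ‖(a 0)⁻¹ • (a 0 • (1 : 𝒜) - Φ)‖ < 1 := by
    rw [norm_smul, norm_sub_rev, norm_inv, Real.norm_eq_abs, inv_mul_lt_iff₀ (abs_pos.2 ha0)]
    linarith
  have h4 := isUnit_one_sub_of_norm_lt_one h3
  have h5 : Φ = a 0 • (1 - (a 0)⁻¹ • (a 0 • (1 : 𝒜) - Φ)) := by
    rw [smul_sub, smul_smul, mul_inv_cancel₀ ha0, one_smul]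
    abel
  rw [h5]
  exact (isUnit_smul_iff (Units.mk0 (a 0) ha0) _).2 h4

variable {ℬ : Type} [NormedAddCommGroup ℬ] [NormedSpace ℝ ℬ] [CompleteSpace ℬ]
variable {W : Type} [NormedAddCommGroup W] [NormedSpace ℝ W] [FiniteDimensional ℝ W]

lemma exists_opExt [Nontrivial ℬ] (f : ℝ × W → ℝ) (p : FormalMultilinearSeries ℝ (ℝ × W) ℝ)
    (hf : HasFPowerSeriesAt f p 0) :
    ∃ G : (ℬ →L[ℝ] ℬ) × W → (ℬ →L[ℝ] ℬ), ∃ r > 0, AnalyticOnNhd ℝ G (ball 0 r) ∧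
      (∀ s w t, ‖s‖ < r → ‖w‖ < r → |t| < r → ∀ ε : ℬ →L[ℝ] ℝ, (∀ u, ε (s u) = t * ε u) →
        ∀ u, ε (G (s, w) u) = f (t, w) * ε u) ∧
      (∀ s, ‖s‖ < r → HasSum (fun k => p k (fun _ => ((1 : ℝ), (0 : W))) • s ^ k) (G (s, 0))) := by
  let b := Module.finBasis ℝ (ℝ × W)
  let ℓ : Fin (Module.finrank ℝ (ℝ × W)) → (ℬ →L[ℝ] ℬ) × W →L[ℝ] (ℬ →L[ℝ] ℬ) := fun i =>
    b.repr ((1 : ℝ), (0 : W)) i • ContinuousLinearMap.fst ℝ _ _ +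
    ((LinearMap.toContinuousLinearMap
      ((b.coord i).comp (LinearMap.inr ℝ ℝ W))).smulRight (1 : ℬ →L[ℝ] ℬ)).comp
      (ContinuousLinearMap.snd ℝ _ _)
  have hℓ : ∀ i s w, ℓ i (s, w) = b.repr ((1 : ℝ), (0 : W)) i • s + b.repr ((0 : ℝ), w) i • 1 := by
    intro i s w
    rfl
  obtain ⟨G, r, hr, h1, h2, h3⟩ := exists_tilde b ℓ f p hf
  refine ⟨G, r, hr, h1, ?_, ?_⟩
  · intro s w t hs hw ht ε hε u
    have := h2 (s, w) (by simp [hs, hw]) (t, w) (by simp [ht, hw])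
      (ε.comp (ContinuousLinearMap.apply ℝ ℬ u)) ?_
    · simpa using this
    · intro i a
      have e : ((t, w) : ℝ × W) = t • ((1 : ℝ), (0 : W)) + ((0 : ℝ), w) := by simp
      have e' : b.repr (t, w) i = t * b.repr ((1 : ℝ), (0 : W)) i + b.repr ((0 : ℝ), w) i := by
        rw [e, map_add, map_smul]
        rfl
      rw [e', hℓ]
      simp [hε]
      ring
  · intro s hs
    refine h3 (s, 0) (by simp [hs]) _ s ?_
    intro i
    rw [hℓ]
    have : ((0 : ℝ), (0 : W)) = 0 := rfl
    rw [this]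
    simp

lemma weier_core (B : ShiftData ℬ) (f : ℝ × W → ℝ) (p : FormalMultilinearSeries ℝ (ℝ × W) ℝ)
    (hf : HasFPowerSeriesAt f p 0) (d : ℕ)
    (hlt : ∀ k < d, p k (fun _ => ((1 : ℝ), (0 : W))) = 0)
    (hd : p d (fun _ => ((1 : ℝ), (0 : W))) ≠ 0) :
    ∃ ρ0 > 0, ∀ ρ, 0 < ρ → ρ < ρ0 → ∀ γ : W → ℬ, AnalyticAt ℝ γ 0 →
      ∃ (q : ℝ × W → ℝ) (r : ℕ → W → ℝ), AnalyticAt ℝ q 0 ∧ (∀ i, AnalyticAt ℝ (r i) 0) ∧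
        (∀ᶠ y in 𝓝 (0 : ℝ × W), B.ev (y.1 / ρ) (γ y.2) =
          f y * q y + ∑ i ∈ Finset.range d, r i y.2 * y.1 ^ i) ∧
        (γ 0 = (B.Sh ^ d) B.e0 → q 0 ≠ 0) := by
  have : Nontrivial ℬ := ⟨B.e0, 0, fun h => by
    have := B.dl_e0
    rw [h, map_zero] at this
    exact zero_ne_one this⟩
  obtain ⟨G, r, hr, hG1, hG2, hG3⟩ := exists_opExt (ℬ := ℬ) f p hf
  obtain ⟨R, hR0, hR⟩ := ENNReal.lt_iff_exists_nnreal_btwn.1 hf.radius_pos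
  have hR0 : 0 < R := by exact_mod_cast hR0
  obtain ⟨C0, hC0, hbd⟩ := p.norm_mul_pow_le_of_lt_radius hR
  set c : ℕ → ℝ := fun k => p k (fun _ => ((1 : ℝ), (0 : W))) with hc
  have hcb : ∀ k, |c k| ≤ ‖p k‖ := by
    intro k
    refine ((p k).le_opNorm _).trans ?_
    simp
  have hR' : (0 : ℝ) < R := hR0
  set C : ℝ := C0 / (R : ℝ) ^ (d + 1) with hCdef
  have hC : 0 < C := by positivity
  have hcd : 0 < |c d| := abs_pos.2 hd
  have hca : ∀ k, |c (d + (k + 1))| * (R : ℝ) ^ k ≤ C := by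
    intro k
    rw [hCdef, le_div_iff₀ (by positivity)]
    calc |c (d + (k + 1))| * (R : ℝ) ^ k * (R : ℝ) ^ (d + 1)
        = |c (d + (k + 1))| * (R : ℝ) ^ (d + (k + 1)) := by ring
      _ ≤ ‖p (d + (k + 1))‖ * (R : ℝ) ^ (d + (k + 1)) := by
        have := hcb (d + (k + 1))
        gcongr
      _ ≤ C0 := hbd _
  refine ⟨min r (min (R / 2) (|c d| / (2 * C))), by positivity, ?_⟩
  intro ρ hρ hρ0 γ hγ
  have hρr : ρ < r := hρ0.trans_le (min_le_left _ _)
  have hρR : ρ < R / 2 := hρ0.trans_le ((min_le_right _ _).trans (min_le_left _ _))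
  have hρc : 2 * C * ρ < |c d| := by
    have := hρ0.trans_le ((min_le_right _ _).trans (min_le_right _ _))
    rw [lt_div_iff₀ (by positivity)] at this
    linarith
  set s : ℬ →L[ℝ] ℬ := ρ • B.Sh with hs
  have hsn : ‖s‖ ≤ ρ := by
    rw [hs, norm_smul, Real.norm_eq_abs, abs_of_pos hρ]
    have := B.Sh_norm
    nlinarith
  have hsr : ‖s‖ < r := hsn.trans_lt hρr
  -- the operator family
  have hA : AnalyticAt ℝ (fun w : W => G (s, w)) 0 := by
    have h1 : AnalyticAt ℝ G (s, 0) := hG1 _ (by simp [hsr])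
    exact AnalyticAt.comp_of_eq (f := fun w : W => (s, w)) h1 (AnalyticAt.prod analyticAt_const analyticAt_id) rfl
  set A : W → ℬ →L[ℝ] ℬ := fun w => G (s, w) with hAdef
  have hΨ : AnalyticAt ℝ (fun w : W => B.Lf ^ d * A w) 0 := analyticAt_const.mul hA
  set Ψ : W → ℬ →L[ℝ] ℬ := fun w => B.Lf ^ d * A w with hΨdef
  have hsum : HasSum (fun k => c (d + k) • s ^ k) ((ρ ^ d)⁻¹ • Ψ 0) := by
    have h1 := hG3 s hsr
    have h2 := h1.mul_left (B.Lf ^ d)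
    have h3 := (hasSum_nat_add_iff' d).2 h2
    have h4 : ∑ i ∈ Finset.range d, B.Lf ^ d * (c i • s ^ i) = 0 := by
      refine Finset.sum_eq_zero fun i hi => ?_
      have : c i = 0 := hlt i (Finset.mem_range.1 hi)
      rw [this, zero_smul, mul_zero]
    have h5 := h3.const_smul ((ρ ^ d)⁻¹)
    change HasSum (fun n => (ρ ^ d)⁻¹ • (B.Lf ^ d * (c (n + d) • s ^ (n + d))))
      ((ρ ^ d)⁻¹ • (Ψ 0 - ∑ i ∈ Finset.range d, B.Lf ^ d * (c i • s ^ i))) at h5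
    rw [h4, sub_zero] at h5
    convert! h5 using 2 with k
    rw [mul_smul_comm, hs, smul_pow, smul_pow, mul_smul_comm, add_comm k d, B.Lf_pow_Sh_pow, smul_smul,
      smul_smul, smul_smul]
    congr 1
    rw [pow_add]
    field_simp
  have hunit : IsUnit (Ψ 0) := by
    have h1 : IsUnit ((ρ ^ d)⁻¹ • Ψ 0) :=
      isUnit_of_hasSum (a := fun k => c (d + k)) hC hρ hρR.le hsn hca hρc hsum
    exact (isUnit_smul_iff (Units.mk0 ((ρ ^ d)⁻¹) (by positivity)) _).1 h1
  have hdl : ∀ u, B.dl (Ψ 0 u) = ρ ^ d * c d * B.dl u := by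
    intro u
    have h1 := hsum.mapL (B.dl.comp (ContinuousLinearMap.apply ℝ ℬ u))
    have h2 : HasSum (fun k => (B.dl.comp (ContinuousLinearMap.apply ℝ ℬ u)) (c (d + k) • s ^ k))
        ((B.dl.comp (ContinuousLinearMap.apply ℝ ℬ u)) (c (d + 0) • s ^ 0)) := by
      refine hasSum_single 0 fun k hk => ?_
      obtain ⟨k, rfl⟩ := Nat.exists_eq_succ_of_ne_zero hk
      rw [Nat.succ_eq_add_one, pow_succ']
      change B.dl (c (d + (k + 1)) • (ρ • B.Sh ((s ^ k) u))) = 0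
      rw [map_smul, map_smul, B.dl_Sh, smul_zero, smul_zero]
    have h3 := h1.unique h2
    change B.dl ((ρ ^ d)⁻¹ • (Ψ 0 u)) = B.dl (c (d + 0) • u) at h3
    rw [map_smul, map_smul, add_zero, smul_eq_mul, smul_eq_mul, inv_mul_eq_iff_eq_mul₀ (by positivity)] at h3
    rw [h3]
    ring
  have hinv : AnalyticAt ℝ (fun w => Ring.inverse (Ψ w)) 0 := by
    obtain ⟨U, hU⟩ := hunit
    refine AnalyticAt.comp_of_eq (analyticAt_inverse (𝕜 := ℝ) U) hΨ hU.symm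
  have hqv : AnalyticAt ℝ (fun w => Ring.inverse (Ψ w) ((B.Lf ^ d) (γ w))) 0 :=
    an_clm_apply hinv (((B.Lf ^ d).analyticAt _).comp hγ)
  set qv : W → ℬ := fun w => Ring.inverse (Ψ w) ((B.Lf ^ d) (γ w)) with hqvdef
  have hm : AnalyticAt ℝ (fun w => γ w - A w (qv w)) 0 := hγ.sub (an_clm_apply hA hqv)
  set m : W → ℬ := fun w => γ w - A w (qv w) with hmdef
  have hΨev : ∀ᶠ w in 𝓝 (0 : W), IsUnit (Ψ w) :=
    hΨ.continuousAt.eventually (Units.isOpen.mem_nhds hunit)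
  refine ⟨fun y => B.ev (y.1 / ρ) (qv y.2), fun i w => (ρ ^ i)⁻¹ * B.dl ((B.Lf ^ i) (m w)),
    ?_, ?_, ?_, ?_⟩
  · refine an_clm_apply ?_ ?_
    · refine AnalyticAt.comp_of_eq (f := fun y : ℝ × W => y.1 / ρ) B.ev_analytic ?_ (by simp)
      exact analyticAt_fst.div_const
    · exact AnalyticAt.comp_of_eq (f := fun y : ℝ × W => y.2) hqv analyticAt_snd rfl
  · intro i
    refine analyticAt_const.mul ?_
    exact ((B.dl.comp (B.Lf ^ i)).analyticAt _).comp hm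
  · have t1 : Filter.Tendsto (fun y : ℝ × W => y.1) (𝓝 0) (𝓝 0) := continuous_fst.tendsto' _ _ rfl
    have t2 : Filter.Tendsto (fun y : ℝ × W => y.2) (𝓝 0) (𝓝 0) := continuous_snd.tendsto' _ _ rfl
    filter_upwards [t1.eventually (ball_mem_nhds _ hρ), t2.eventually (ball_mem_nhds _ hr),
      t2.eventually hΨev] with y hy1 hy2 hy3
    have hy1 : |y.1| < ρ := by simpa using hy1
    have hy2 : ‖y.2‖ < r := by simpa using hy2
    have hτ : |y.1 / ρ| < 1 := by
      rw [abs_div, abs_of_pos hρ, div_lt_one hρ]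
      exact hy1
    have e1 : (B.Lf ^ d) (m y.2) = 0 := by
      have h1 := congrArg (fun T : ℬ →L[ℝ] ℬ => T ((B.Lf ^ d) (γ y.2))) (Ring.mul_inverse_cancel _ hy3)
      change (B.Lf ^ d) (A y.2 (qv y.2)) = (B.Lf ^ d) (γ y.2) at h1
      rw [hmdef]
      simp only
      rw [map_sub, h1, sub_self]
    have e2 := B.ev_poly hτ d _ e1
    have e3 := hG2 s y.2 y.1 hsr hy2 (hy1.trans hρr) (B.ev (y.1 / ρ)) (fun u => by
      change B.ev (y.1 / ρ) (ρ • B.Sh u) = _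
      rw [map_smul, B.ev_Sh hτ, smul_eq_mul]
      field_simp) (qv y.2)
    have e4 : γ y.2 = A y.2 (qv y.2) + m y.2 := by simp [hmdef]
    rw [e4, map_add, e2]
    congr 1
    refine Finset.sum_congr rfl fun i _ => ?_
    rw [div_pow]
    field_simp
  · intro h0
    change B.ev ((0 : ℝ) / ρ) (qv 0) ≠ 0
    rw [zero_div, B.ev_zero]
    intro h
    have h1 := congrArg (fun T : ℬ →L[ℝ] ℬ => T ((B.Lf ^ d) (γ 0))) (Ring.mul_inverse_cancel _ hunit)
    change Ψ 0 (qv 0) = (B.Lf ^ d) (γ 0) at h1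
    have h2 := hdl (qv 0)
    rw [h1, h, mul_zero, h0] at h2
    have h3 := congrArg (fun T : ℬ →L[ℝ] ℬ => T B.e0) (B.Lf_pow_Sh_pow d 0)
    change (B.Lf ^ d) ((B.Sh ^ d) B.e0) = B.e0 at h3
    rw [h3, B.dl_e0] at h2
    exact one_ne_zero h2

lemma ev_Sh_pow_e0 (B : ShiftData ℬ) {τ : ℝ} (h : |τ| < 1) (d : ℕ) :
    B.ev τ ((B.Sh ^ d) B.e0) = τ ^ d := by
  induction d with
  | zero => exact B.ev_e0 h
  | succ d ih =>
    rw [pow_succ']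
    change B.ev τ (B.Sh ((B.Sh ^ d) B.e0)) = _
    rw [B.ev_Sh h, ih, pow_succ']

/-- Weierstrass division -/
lemma weier_div (f : ℝ × W → ℝ) (p : FormalMultilinearSeries ℝ (ℝ × W) ℝ)
    (hf : HasFPowerSeriesAt f p 0) (d : ℕ)
    (hlt : ∀ k < d, p k (fun _ => ((1 : ℝ), (0 : W))) = 0)
    (hd : p d (fun _ => ((1 : ℝ), (0 : W))) ≠ 0) (g : ℝ × W → ℝ) (hg : AnalyticAt ℝ g 0) :
    ∃ (q : ℝ × W → ℝ) (r : ℕ → W → ℝ), AnalyticAt ℝ q 0 ∧ (∀ i, AnalyticAt ℝ (r i) 0) ∧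
      ∀ᶠ y in 𝓝 (0 : ℝ × W), g y = f y * q y + ∑ i ∈ Finset.range d, r i y.2 * y.1 ^ i := by
  let B := shiftBs
  have : Nontrivial Bs := ⟨B.e0, 0, fun h => by
    have := B.dl_e0
    rw [h, map_zero] at this
    exact zero_ne_one this⟩
  obtain ⟨ρ0, hρ0, H⟩ := weier_core B f p hf d hlt hd
  obtain ⟨p', hp'⟩ := hg
  obtain ⟨G, r, hr, hG1, hG2, -⟩ := exists_opExt (ℬ := Bs) g p' hp'
  obtain ⟨ρ, hρ, hρ'⟩ := exists_between (lt_min hρ0 hr)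
  have hsr : ‖ρ • B.Sh‖ < r := by
    rw [norm_smul, Real.norm_eq_abs, abs_of_pos hρ]
    have := B.Sh_norm
    have : ρ * ‖B.Sh‖ ≤ ρ * 1 := by gcongr
    linarith [hρ'.trans_le (min_le_right ρ0 r)]
  have hA : AnalyticAt ℝ (fun w : W => G (ρ • B.Sh, w) B.e0) 0 := by
    have h1 : AnalyticAt ℝ G (ρ • B.Sh, 0) := hG1 _ (by simp [hsr])
    have h2 : AnalyticAt ℝ (fun w : W => G (ρ • B.Sh, w)) 0 :=
      AnalyticAt.comp_of_eq (f := fun w : W => (ρ • B.Sh, w)) h1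
        (AnalyticAt.prod analyticAt_const analyticAt_id) rfl
    exact an_clm_apply h2 analyticAt_const
  obtain ⟨q, rr, h1, h2, h3, -⟩ := H ρ hρ (hρ'.trans_le (min_le_left _ _)) _ hA
  refine ⟨q, rr, h1, h2, ?_⟩
  have t1 : Filter.Tendsto (fun y : ℝ × W => y.1) (𝓝 0) (𝓝 0) := continuous_fst.tendsto' _ _ rfl
  have t2 : Filter.Tendsto (fun y : ℝ × W => y.2) (𝓝 0) (𝓝 0) := continuous_snd.tendsto' _ _ rfl
  filter_upwards [h3, t1.eventually (ball_mem_nhds _ hρ), t2.eventually (ball_mem_nhds _ hr)]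
    with y h3 hy1 hy2
  have hy1 : |y.1| < ρ := by simpa using hy1
  have hy2 : ‖y.2‖ < r := by simpa using hy2
  have hτ : |y.1 / ρ| < 1 := by
    rw [abs_div, abs_of_pos hρ, div_lt_one hρ]
    exact hy1
  rw [← h3]
  rw [hG2 (ρ • B.Sh) y.2 y.1 hsr hy2 (hy1.trans (hρ'.trans_le (min_le_right _ _)))
    (B.ev (y.1 / ρ)) (fun u => by
      change B.ev (y.1 / ρ) (ρ • B.Sh u) = _
      rw [map_smul, B.ev_Sh hτ, smul_eq_mul]
      field_simp) B.e0, B.ev_e0 hτ, mul_one]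

/-- Weierstrass preparation -/
lemma weier_prep (f : ℝ × W → ℝ) (p : FormalMultilinearSeries ℝ (ℝ × W) ℝ)
    (hf : HasFPowerSeriesAt f p 0) (d : ℕ)
    (hlt : ∀ k < d, p k (fun _ => ((1 : ℝ), (0 : W))) = 0)
    (hd : p d (fun _ => ((1 : ℝ), (0 : W))) ≠ 0) :
    ∃ (q : ℝ × W → ℝ) (r : ℕ → W → ℝ), AnalyticAt ℝ q 0 ∧ (∀ i, AnalyticAt ℝ (r i) 0) ∧
      q 0 ≠ 0 ∧
      ∀ᶠ y in 𝓝 (0 : ℝ × W), y.1 ^ d = f y * q y + ∑ i ∈ Finset.range d, r i y.2 * y.1 ^ i := by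
  let B := shiftBs
  obtain ⟨ρ0, hρ0, H⟩ := weier_core B f p hf d hlt hd
  obtain ⟨ρ, hρ, hρ'⟩ := exists_between hρ0
  obtain ⟨q, rr, h1, h2, h3, h4⟩ := H ρ hρ hρ' (fun _ => (B.Sh ^ d) B.e0) analyticAt_const
  refine ⟨fun y => ρ ^ d * q y, fun i w => ρ ^ d * rr i w, analyticAt_const.mul h1,
    fun i => analyticAt_const.mul (h2 i), mul_ne_zero (by positivity) (h4 rfl), ?_⟩
  have t1 : Filter.Tendsto (fun y : ℝ × W => y.1) (𝓝 0) (𝓝 0) := continuous_fst.tendsto' _ _ rfl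
  filter_upwards [h3, t1.eventually (ball_mem_nhds _ hρ)] with y h3 hy1
  have hy1 : |y.1| < ρ := by simpa using hy1
  have hτ : |y.1 / ρ| < 1 := by
    rw [abs_div, abs_of_pos hρ, div_lt_one hρ]
    exact hy1
  rw [ev_Sh_pow_e0 B hτ, div_pow, div_eq_iff (by positivity)] at h3
  rw [h3, add_mul, Finset.sum_mul]
  congr 1
  · ring
  · exact Finset.sum_congr rfl fun i _ => by ring
end weier

section step
variable {W : Type} [NormedAddCommGroup W] [NormedSpace ℝ W] [FiniteDimensional ℝ W]
  {x : ℕ → ℝ × W} (hx : Filter.Tendsto x (Filter.hyperfilter ℕ : _root_.Filter ℕ) (𝓝 0))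
  {f : ℝ × W → ℝ} {p : FormalMultilinearSeries ℝ (ℝ × W) ℝ}
  (hf : HasFPowerSeriesAt f p 0) (hfx : gm (fun k => f (x k)) = 0) {d : ℕ}
  (hlt : ∀ k < d, p k (fun _ => ((1 : ℝ), (0 : W))) = 0)
  (hd : p d (fun _ => ((1 : ℝ), (0 : W))) ≠ 0)
include hx hf hfx hlt hd

lemma step_integral {z : HL} (hz : z ∈ anRing x) : IsIntegral (anRing (fun k => (x k).2)) z := by
  set R := anRing (fun k => (x k).2) with hR
  have hmem : ∀ r : W → ℝ, AnalyticAt ℝ r 0 → IsIntegral R (gm (fun k => r (x k).2)) := by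
    intro r hr
    exact isIntegral_algebraMap (R := R) (x := ⟨gm (fun k => r (x k).2), r, hr, rfl⟩)
  have hT : IsIntegral R (gm (fun k => (x k).1)) := by
    obtain ⟨q, r, -, hr, -, h⟩ := weier_prep f p hf d hlt hd
    let a : ℕ → R := fun i => ⟨gm (fun k => r i (x k).2), r i, hr i, rfl⟩
    refine ⟨Polynomial.X ^ d - ∑ i ∈ Finset.range d, Polynomial.monomial i (a i), ?_, ?_⟩
    · apply Polynomial.monic_X_pow_sub
      refine (Polynomial.degree_sum_le _ _).trans_lt ?_
      rw [Finset.sup_lt_iff (WithBot.bot_lt_coe _)]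
      intro j hj
      refine (Polynomial.degree_monomial_le _ _).trans_lt ?_
      simpa using hj
    · rw [Polynomial.eval₂_sub, Polynomial.eval₂_X_pow, Polynomial.eval₂_finsetSum]
      simp only [Polynomial.eval₂_monomial]
      have h1 := gm_eq.2 (hx.eventually h)
      rw [gm_add, gm_mul, hfx, zero_mul, zero_add, gm_sum] at h1
      simp only [gm_mul, gm_pow] at h1
      rw [h1, sub_eq_zero]
      rfl
  obtain ⟨g, hg, rfl⟩ := hz
  obtain ⟨q, r, -, hr, h⟩ := weier_div f p hf d hlt hd g hg
  have h1 := gm_eq.2 (hx.eventually h)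
  rw [gm_add, gm_mul, hfx, zero_mul, zero_add, gm_sum] at h1
  simp only [gm_mul, gm_pow] at h1
  rw [h1]
  exact IsIntegral.sum _ fun i _ => (hmem _ (hr i)).mul (hT.pow i)

lemma step_alg {z : HL} (hz : IsAlgebraic (anRing x) z) :
    IsAlgebraic (anRing (fun k => (x k).2)) z := by
  have hle : anRing (fun k => (x k).2) ≤ anRing x := by
    rintro _ ⟨r, hr, rfl⟩
    exact ⟨fun y => r y.2, AnalyticAt.comp_of_eq (f := fun y : ℝ × W => y.2) hr analyticAt_snd rfl, rfl⟩
  let _ : Algebra (anRing (fun k => (x k).2)) (anRing x) := (Subring.inclusion hle).toAlgebra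
  have : IsScalarTower (anRing (fun k => (x k).2)) (anRing x) HL := .of_algebraMap_eq fun _ => rfl
  have : Algebra.IsAlgebraic (anRing (fun k => (x k).2)) (anRing x) := by
    constructor
    intro a
    have h1 := step_integral hx hf hfx hlt hd a.2
    have h2 : IsIntegral (anRing (fun k => (x k).2)) (algebraMap (anRing x) HL a) := h1
    have h3 := (isIntegral_algebraMap_iff (R := anRing (fun k => (x k).2))
      (FaithfulSMul.algebraMap_injective (anRing x) HL)).1 h2
    exact h3.isAlgebraic
  exact hz.restrictScalars _

lemma step_der {D : Derivation ℤ HL HL} (hD : AnDer (fun k => (x k).2) D) : AnDer x D := by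
  obtain ⟨v', hv'⟩ := hD
  obtain ⟨u, hu⟩ := gm_surj (D (gm (fun k => (x k).1)))
  set v : ℕ → ℝ × W := fun k => (u k, v' k) with hv
  let Good : (ℝ × W → ℝ) → Prop := fun g =>
    AnalyticAt ℝ g 0 ∧ D (gm (fun k => g (x k))) = gm (fun k => fderiv ℝ g (x k) (v k))
  have gadd : ∀ g h, Good g → Good h → Good (fun y => g y + h y) := by
    rintro g h ⟨hg1, hg2⟩ ⟨hh1, hh2⟩
    refine ⟨hg1.add hh1, ?_⟩
    rw [gm_add, map_add, hg2, hh2, gm_fderiv_add hx hg1 hh1]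
  have gmul : ∀ g h, Good g → Good h → Good (fun y => g y * h y) := by
    rintro g h ⟨hg1, hg2⟩ ⟨hh1, hh2⟩
    refine ⟨hg1.mul hh1, ?_⟩
    rw [gm_mul, D.leibniz, hg2, hh2, gm_fderiv_mul hx hg1 hh1]
    rfl
  have gfst : Good (fun y => y.1) := by
    refine ⟨analyticAt_fst, ?_⟩
    rw [← hu, gm_eq]
    refine Filter.Eventually.of_forall fun k => ?_
    rw [fderiv_fst]
    rfl
  have gsnd : ∀ r : W → ℝ, AnalyticAt ℝ r 0 → Good (fun y => r y.2) := by
    intro r hr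
    refine ⟨AnalyticAt.comp_of_eq (f := fun y : ℝ × W => y.2) hr analyticAt_snd rfl, ?_⟩
    rw [hv' r hr, gm_eq]
    have t2 : Filter.Tendsto (fun y : ℝ × W => y.2) (𝓝 0) (𝓝 0) := continuous_snd.tendsto' _ _ rfl
    filter_upwards [(t2.comp hx).eventually hr.eventually_analyticAt] with k hk
    have h1 : HasFDerivAt (fun y : ℝ × W => r y.2)
        ((fderiv ℝ r (x k).2).comp (ContinuousLinearMap.snd ℝ ℝ W)) (x k) :=
      HasFDerivAt.comp (x k) hk.differentiableAt.hasFDerivAt hasFDerivAt_snd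
    rw [h1.fderiv]
    rfl
  have gone : Good (fun _ => 1) := gsnd (fun _ => 1) analyticAt_const
  have gpow : ∀ i : ℕ, Good (fun y => y.1 ^ i) := by
    intro i
    induction i with
    | zero => simpa using gone
    | succ i ih =>
      have := gmul _ _ ih gfst
      simpa [pow_succ] using this
  have gpoly : ∀ (r : ℕ → W → ℝ), (∀ i, AnalyticAt ℝ (r i) 0) → ∀ n : ℕ,
      Good (fun y => ∑ i ∈ Finset.range n, r i y.2 * y.1 ^ i) := by
    intro r hr n
    induction n with
    | zero => simpa using gsnd (fun _ => 0) analyticAt_const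
    | succ n ih =>
      have := gadd _ _ ih (gmul _ _ (gsnd _ (hr n)) (gpow n))
      simpa [Finset.sum_range_succ] using this
  have hfa : AnalyticAt ℝ f 0 := ⟨p, hf⟩
  -- general identity
  have hid : ∀ (g q : ℝ × W → ℝ) (r : ℕ → W → ℝ), AnalyticAt ℝ q 0 → (∀ i, AnalyticAt ℝ (r i) 0) →
      (∀ᶠ y in 𝓝 (0 : ℝ × W), g y = f y * q y + ∑ i ∈ Finset.range d, r i y.2 * y.1 ^ i) →
      D (gm (fun k => g (x k))) + gm (fun k => q (x k)) * gm (fun k => fderiv ℝ f (x k) (v k))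
        = gm (fun k => fderiv ℝ g (x k) (v k)) := by
    intro g q r hq hr h
    obtain ⟨e1, e2⟩ := gpoly r hr d
    rw [gm_fderiv_congr hx h v, gm_fderiv_add (f := fun y => f y * q y) hx (hfa.mul hq) e1, gm_fderiv_mul hx hfa hq, hfx,
      gm_eq.2 (hx.eventually h), gm_add, gm_mul, hfx, map_add, e2, zero_mul, zero_mul, map_zero,
      zero_add, zero_add, add_comm]
  have hf0 : gm (fun k => fderiv ℝ f (x k) (v k)) = 0 := by
    obtain ⟨q, r, hq, hr, hq0, h⟩ := weier_prep f p hf d hlt hd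
    have h1 := hid _ q r hq hr h
    rw [(gpow d).2] at h1
    have h2 := add_eq_left.1 h1
    rcases mul_eq_zero.1 h2 with h3 | h3
    · exfalso
      rw [← gm_zero, gm_eq] at h3
      have h4 := hx.eventually (hq.continuousAt.eventually_ne hq0)
      obtain ⟨k, hk1, hk2⟩ := (h3.and h4).exists
      exact hk2 hk1
    · exact h3
  refine ⟨v, fun g hg => ?_⟩
  obtain ⟨q, r, hq, hr, h⟩ := weier_div f p hf d hlt hd g hg
  have h1 := hid g q r hq hr h
  rw [hf0, mul_zero, add_zero] at h1
  exact h1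
end step

lemma thmP (n : ℕ) : ∀ (V : Type) [NormedAddCommGroup V] [NormedSpace ℝ V] [FiniteDimensional ℝ V],
    Module.finrank ℝ V = n → ∀ x : ℕ → V,
    Filter.Tendsto x (Filter.hyperfilter ℕ : _root_.Filter ℕ) (𝓝 0) →
    ∀ z : HL, IsAlgebraic (anRing x) z → (∀ D, AnDer x D → D z = 0) →
    ∃ c : ℝ, z = gm (fun _ => c) := by
  induction n with
  | zero =>
    intro V _ _ _ hV x hx z hz hD
    refine indep_case hx ?_ z hz hD
    have : Subsingleton V := Module.finrank_zero_iff.1 hV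
    intro f hf h
    rw [← gm_zero, gm_eq] at h
    obtain ⟨k, hk⟩ := h.exists
    refine Filter.Eventually.of_forall fun y => ?_
    rw [Subsingleton.elim y (x k)]
    exact hk
  | succ n ih =>
    intro V _ _ _ hV x hx z hz hD
    by_cases hind : ∀ f : V → ℝ, AnalyticAt ℝ f 0 → gm (fun k => f (x k)) = 0 → f =ᶠ[𝓝 0] 0
    · exact indep_case hx hind z hz hD
    push Not at hind
    obtain ⟨f, hfa, hfx, hf0⟩ := hind
    obtain ⟨p, hp⟩ := hfa
    have hf00 : f 0 = 0 := by
      have h1 := gm_eq.1 (hfx.trans gm_zero.symm)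
      have h2 : Filter.Tendsto (fun k => f (x k)) (Filter.hyperfilter ℕ : _root_.Filter ℕ) (𝓝 (f 0)) :=
        hp.continuousAt.tendsto.comp hx
      have h3 : Filter.Tendsto (fun k => f (x k)) (Filter.hyperfilter ℕ : _root_.Filter ℕ) (𝓝 0) :=
        tendsto_const_nhds.congr' (h1.mono fun k hk => hk.symm)
      exact tendsto_nhds_unique h2 h3
    have hex : ∃ v : V, ∃ k, p k (fun _ => v) ≠ 0 := by
      by_contra hcon
      push Not at hcon
      apply hf0
      filter_upwards [hp.eventually_hasSum] with y hy
      simp only [hcon, zero_add] at hy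
      exact hy.unique hasSum_zero
    obtain ⟨v, k0, hk0⟩ := hex
    have hv : v ≠ 0 := by
      rintro rfl
      rcases Nat.eq_zero_or_pos k0 with rfl | hpos
      · exact hk0 ((hp.coeff_zero _).trans hf00)
      · have : Nonempty (Fin k0) := ⟨⟨0, hpos⟩⟩
        exact hk0 ((p k0).map_zero)
    classical
    let hexk : ∃ k, p k (fun _ => v) ≠ 0 := ⟨k0, hk0⟩
    set d := Nat.find hexk with hddef
    have hd : p d (fun _ => v) ≠ 0 := Nat.find_spec hexk
    have hlt : ∀ k < d, p k (fun _ => v) = 0 := fun k hk => by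
      by_contra h
      exact Nat.find_min hexk hk h
    obtain ⟨φ, hφ⟩ := SeparatingDual.exists_eq_one (R := ℝ) hv
    let e : V ≃L[ℝ] ℝ × φ.ker := ContinuousLinearEquiv.equivOfRightInverse φ
      (ContinuousLinearMap.toSpanSingleton ℝ v) (fun t => by simp [hφ])
    have he : e.symm ((1 : ℝ), (0 : φ.ker)) = v := by
      rw [ContinuousLinearEquiv.equivOfRightInverse_symm_apply]
      simp
    have hfin : Module.finrank ℝ φ.ker = n := by
      have h1 := e.toLinearEquiv.finrank_eq
      rw [Module.finrank_prod, Module.finrank_self, hV] at h1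
      omega
    let x' : ℕ → ℝ × φ.ker := fun k => e (x k)
    have hx' : Filter.Tendsto x' (Filter.hyperfilter ℕ : _root_.Filter ℕ) (𝓝 0) :=
      (e.continuous.tendsto' 0 0 (map_zero e)).comp hx
    have hp' : HasFPowerSeriesAt (f ∘ e.symm) (p.compContinuousLinearMap (e.symm : (ℝ × φ.ker) →L[ℝ] V)) 0 := by
      apply HasFPowerSeriesAt.compContinuousLinearMap (u := (e.symm : (ℝ × φ.ker) →L[ℝ] V))
      simpa using hp
    have hpk : ∀ k, p.compContinuousLinearMap (e.symm : (ℝ × φ.ker) →L[ℝ] V) k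
        (fun _ => ((1 : ℝ), (0 : φ.ker))) = p k (fun _ => v) := by
      intro k
      rw [FormalMultilinearSeries.compContinuousLinearMap_apply]
      congr 1
      funext j
      exact he
    have hfx' : gm (fun k => (f ∘ e.symm) (x' k)) = 0 := by
      simpa [x'] using hfx
    have hlt' : ∀ k < d, p.compContinuousLinearMap (e.symm : (ℝ × φ.ker) →L[ℝ] V) k
        (fun _ => ((1 : ℝ), (0 : φ.ker))) = 0 := fun k hk => (hpk k).trans (hlt k hk)
    have hd' : p.compContinuousLinearMap (e.symm : (ℝ × φ.ker) →L[ℝ] V) d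
        (fun _ => ((1 : ℝ), (0 : φ.ker))) ≠ 0 := by
      rw [hpk]
      exact hd
    have hcs : ∀ g : V → ℝ, AnalyticAt ℝ g 0 → AnalyticAt ℝ (g ∘ e.symm) 0 := fun g hg => by
      refine AnalyticAt.comp_of_eq hg ((e.symm : (ℝ × φ.ker) →L[ℝ] V).analyticAt _) (map_zero e.symm)
    have hring : anRing x ≤ anRing x' := by
      rintro _ ⟨g, hg, rfl⟩
      exact ⟨g ∘ e.symm, hcs g hg, by simp [x']⟩
    have hz' : IsAlgebraic (anRing x') z := by
      let _ : Algebra (anRing x) (anRing x') := (Subring.inclusion hring).toAlgebra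
      have : IsScalarTower (anRing x) (anRing x') HL := .of_algebraMap_eq fun _ => rfl
      exact hz.extendScalars (Subring.inclusion_injective hring)
    have t2 : Filter.Tendsto (fun y : ℝ × φ.ker => y.2) (𝓝 0) (𝓝 0) :=
      continuous_snd.tendsto' _ _ rfl
    refine ih φ.ker hfin (fun k => (x' k).2) (t2.comp hx') z
      (step_alg hx' hp' hfx' hlt' hd' hz') fun D hDw => hD D ?_
    obtain ⟨v', hv'⟩ := step_der hx' hp' hfx' hlt' hd' hDw
    refine ⟨fun k => e.symm (v' k), fun g hg => ?_⟩
    have h1 := hv' _ (hcs g hg)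
    simp only [ContinuousLinearEquiv.comp_right_fderiv, x', Function.comp,
      ContinuousLinearEquiv.symm_apply_apply] at h1
    refine h1.trans ?_
    rfl

/-- Key theorem: near the origin, on the zero fibre no nonzero point is critical for the norm. -/
lemma key_thm {V : Type} [NormedAddCommGroup V] [InnerProductSpace ℝ V] [FiniteDimensional ℝ V]
    {ι : Type} [Fintype ι] (G : ι → V → ℝ) (hG : ∀ i, AnalyticAt ℝ (G i) 0) :
    ∀ᶠ x in 𝓝 (0 : V), (∀ i, G i x = 0) →
      (∀ v, (∀ i, fderiv ℝ (G i) x v = 0) → inner ℝ x v = 0) → x = 0 := by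
  by_contra hcon
  rw [Filter.not_eventually] at hcon
  obtain ⟨x, hx, hxp⟩ := Filter.exists_seq_forall_of_frequently hcon
  have hx' : Filter.Tendsto x (Filter.hyperfilter ℕ : _root_.Filter ℕ) (𝓝 0) :=
    hx.mono_left Nat.hyperfilter_le_atTop
  push Not at hxp
  have hns : AnalyticAt ℝ (fun y : V => ‖y‖ ^ 2) 0 := by
    have : (fun y : V => ‖y‖ ^ 2) = fun y => inner ℝ y y := by
      funext y
      exact (real_inner_self_eq_norm_sq y).symm
    rw [this]
    exact AnalyticAt.comp_of_eq (f := fun y : V => (y, y))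
      ((innerSL ℝ (E := V)).analyticAt_bilinear (0, 0)) (analyticAt_id.prod analyticAt_id) rfl
  obtain ⟨c, hc⟩ := thmP _ V rfl x hx' (gm (fun k => ‖x k‖ ^ 2))
    (isAlgebraic_algebraMap (R := anRing x)
      (⟨gm (fun k => ‖x k‖ ^ 2), fun y => ‖y‖ ^ 2, hns, rfl⟩ : anRing x)) (by
      rintro D ⟨v, hv⟩
      rw [hv (fun y => ‖y‖ ^ 2) hns, ← gm_zero, gm_eq]
      have h1 : ∀ i, ∀ᶠ k in (Filter.hyperfilter ℕ : _root_.Filter ℕ), fderiv ℝ (G i) (x k) (v k) = 0 := by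
        intro i
        have h2 := hv (G i) (hG i)
        have h3 : gm (fun k => G i (x k)) = 0 := by
          rw [← gm_zero, gm_eq]
          exact Filter.Eventually.of_forall fun k => (hxp k).1 i
        rw [h3, map_zero, ← gm_zero] at h2
        exact gm_eq.1 h2.symm
      filter_upwards [Filter.eventually_all.2 h1] with k hk
      have h4 := (hxp k).2.1 (v k) hk
      rw [(hasStrictFDerivAt_norm_sq (x k)).hasFDerivAt.fderiv]
      simp [h4])
  have h1 := gm_eq.1 hc
  have h2 : Filter.Tendsto (fun k => ‖x k‖ ^ 2) (Filter.hyperfilter ℕ : _root_.Filter ℕ) (𝓝 0) := by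
    have := hx'.norm.pow 2
    simpa using this
  have h3 : Filter.Tendsto (fun k => ‖x k‖ ^ 2) (Filter.hyperfilter ℕ : _root_.Filter ℕ) (𝓝 c) :=
    tendsto_const_nhds.congr' (h1.mono fun k hk => hk.symm)
  have hc0 : c = 0 := tendsto_nhds_unique h3 h2
  obtain ⟨k, hk⟩ := h1.exists
  rw [hc0] at hk
  exact (hxp k).2.2 (by simpa using hk)

lemma fderiv_pair {E F : Type} [NormedAddCommGroup E] [InnerProductSpace ℝ E]
    [NormedAddCommGroup F] [NormedSpace ℝ F] {P : E → F} {x : E} (h : DifferentiableAt ℝ P x) (v : E) :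
    fderiv ℝ (fun y => (P y, ‖y‖ ^ 2)) x v = (fderiv ℝ P x v, 2 * inner ℝ x v) := by
  have h1 := h.hasFDerivAt.prodMk (hasStrictFDerivAt_norm_sq x).hasFDerivAt
  rw [h1.fderiv]
  simp


/-- Let M ≥ N ≥ 3, F tame with Disc F ⊆ {0}, and π : ℝ^N → ℝ^{N-1} the
canonical projection. Then π ∘ F is tame and Disc(π ∘ F) ⊆ {0}. -/
theorem stmt_12 {M N : ℕ} (hMN : M ≥ N) (hN3 : N ≥ 3)
    (U : Set (EuclideanSpace ℝ (Fin M)))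
    (hUopen : IsOpen U) (hU0 : (0 : EuclideanSpace ℝ (Fin M)) ∈ U)
    (F : EuclideanSpace ℝ (Fin M) → EuclideanSpace ℝ (Fin N))
    (hF : AnalyticOnNhd ℝ F U) (hF0 : F 0 = 0)
    (hFtame : Tame F) (hDiscF : F '' (Sing F ∩ U) ⊆ {0})
    (π : EuclideanSpace ℝ (Fin N) → EuclideanSpace ℝ (Fin (N - 1)))
    (hπ : ∀ (y : EuclideanSpace ℝ (Fin N)) (i : Fin (N - 1)),
      π y i = y (Fin.castLE (Nat.sub_le N 1) i)) :
    Tame (π ∘ F) ∧ (π ∘ F) '' (Sing (π ∘ F) ∩ U) ⊆ {0} := by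
  let πL : EuclideanSpace ℝ (Fin N) →L[ℝ] EuclideanSpace ℝ (Fin (N - 1)) :=
    LinearMap.toContinuousLinearMap
      { toFun := π
        map_add' := fun a b => by
          ext i
          simp [hπ]
        map_smul' := fun c a => by
          ext i
          simp [hπ] }
  have hπL : ∀ y, πL y = π y := fun _ => rfl
  have hπsurj : Function.Surjective π := by
    intro z
    refine ⟨WithLp.toLp 2 (fun i => if h : (i : ℕ) < N - 1 then z ⟨i, h⟩ else 0), ?_⟩
    ext i
    rw [hπ]
    simp
  have hdF : ∀ x ∈ U, DifferentiableAt ℝ F x := fun x hx => (hF x hx).differentiableAt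
  have hGa : ∀ x ∈ U, AnalyticAt ℝ (π ∘ F) x := fun x hx => (πL.analyticAt _).comp (hF x hx)
  have hdG : ∀ x ∈ U, DifferentiableAt ℝ (π ∘ F) x := fun x hx => (hGa x hx).differentiableAt
  have hfd : ∀ x ∈ U, ∀ v, fderiv ℝ (π ∘ F) x v = π (fderiv ℝ F x v) := by
    intro x hx v
    have h1 : HasFDerivAt (π ∘ F) (πL.comp (fderiv ℝ F x)) x :=
      HasFDerivAt.comp x πL.hasFDerivAt (hdF x hx).hasFDerivAt
    rw [h1.fderiv]
    rfl
  have hSing : ∀ x ∈ U, x ∈ Sing (π ∘ F) → x ∈ Sing F := by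
    intro x hx h hs
    apply h
    intro z
    obtain ⟨y, rfl⟩ := hπsurj z
    obtain ⟨v, rfl⟩ := hs y
    exact ⟨v, hfd x hx v⟩
  have hMil : ∀ x ∈ U, x ∈ MilnorSet (π ∘ F) → x ∈ MilnorSet F := by
    rintro x hx h hs
    apply h
    rintro ⟨z, b⟩
    obtain ⟨y, rfl⟩ := hπsurj z
    obtain ⟨v, hv⟩ := hs (y, b)
    rw [fderiv_pair (hdF x hx)] at hv
    refine ⟨v, ?_⟩
    rw [fderiv_pair (hdG x hx), hfd x hx]
    rw [Prod.mk.injEq] at hv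
    rw [hv.1, hv.2]
  have hDisc : ∀ x ∈ U, x ∈ Sing F → F x = 0 := fun x hx h => hDiscF ⟨x, ⟨h, hx⟩, rfl⟩
  have hπ0 : π 0 = 0 := map_zero πL
  refine ⟨?_, ?_⟩
  swap
  · rintro _ ⟨x, ⟨h, hx⟩, rfl⟩
    change π (F x) = 0
    rw [hDisc x hx (hSing x hx h), hπ0]
  obtain ⟨ε0, hε0, htame⟩ := hFtame
  have hkey := key_thm (fun i : Fin (N - 1) => fun x => (π ∘ F) x i) (fun i =>
    ((EuclideanSpace.proj (𝕜 := ℝ) i).analyticAt _).comp (hGa 0 hU0))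
  obtain ⟨ε1, hε1, hball⟩ := Metric.eventually_nhds_iff_ball.1 (hkey.and (hUopen.mem_nhds hU0))
  refine ⟨min ε0 ε1, lt_min hε0 hε1, ?_⟩
  have hsub0 : ball (0 : EuclideanSpace ℝ (Fin M)) (min ε0 ε1) ⊆ ball 0 ε0 :=
    ball_subset_ball (min_le_left _ _)
  have hsub1 : ball (0 : EuclideanSpace ℝ (Fin M)) (min ε0 ε1) ⊆ ball 0 ε1 :=
    ball_subset_ball (min_le_right _ _)
  have hincl : (MilnorSet (π ∘ F) \ Sing (π ∘ F)) ∩ ball 0 (min ε0 ε1) ⊆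
      {0} ∪ (MilnorSet F \ Sing F) ∩ ball 0 ε0 := by
    rintro x ⟨⟨hxM, hxS⟩, hxb⟩
    obtain ⟨hk, hxU⟩ := hball x (hsub1 hxb)
    by_cases hxF : x ∈ Sing F
    · left
      have hG0 : (π ∘ F) x = 0 := by
        change π (F x) = 0
        rw [hDisc x hxU hxF, hπ0]
      have hsurj : Function.Surjective (fderiv ℝ (π ∘ F) x) := not_not.1 hxS
      refine hk (fun i => by rw [hG0]; rfl) ?_
      intro v hv
      by_contra hne
      have hv0 : fderiv ℝ (π ∘ F) x v = 0 := by
        ext i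
        have h1 : HasFDerivAt (fun y => (π ∘ F) y i)
            ((EuclideanSpace.proj (𝕜 := ℝ) i).comp (fderiv ℝ (π ∘ F) x)) x :=
          HasFDerivAt.comp x (EuclideanSpace.proj (𝕜 := ℝ) i).hasFDerivAt (hdG x hxU).hasFDerivAt
        have h2 := hv i
        rw [h1.fderiv] at h2
        exact h2
      apply hxM
      rintro ⟨a, b⟩
      obtain ⟨u, rfl⟩ := hsurj a
      refine ⟨u + ((b - 2 * inner ℝ x u) / (2 * inner ℝ x v)) • v, ?_⟩
      rw [fderiv_pair (hdG x hxU), map_add, map_smul, hv0, smul_zero, add_zero, inner_add_right,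
        inner_smul_right]
      congr 1
      field_simp
      ring
    · right
      exact ⟨⟨hMil x hxU hxM, hxF⟩, hsub0 hxb⟩
  rintro y ⟨⟨hy1, hy2⟩, hy3⟩
  have hyU := (hball y (hsub1 hy3)).2
  have h1 := closure_mono hincl hy1
  rw [closure_union, closure_singleton] at h1
  rcases h1 with h1 | h1
  · exact h1
  · exact htame ⟨⟨h1, hSing y hyU hy2⟩, hsub0 hy3⟩
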